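/- arXiv:2310.18068 — 4 statements merged into one kernel-verified Lean document; each statement's English description precedes it below -/
import Mathlib

section
/- Let A and B be finite nonempty subsets of ℝ × ℝ separated by the vertical line x = m, and assume A ∪ B is in general position. Let (α₁, α₂) be an upper supporting pair of A and (β₁, β₂) an upper supporting pair of B, let l be the midpoint of the segment α₁α₂ and r the midpoint of the segment β₁β₂. If the slope of lr is less than or equal to the slope of β₁β₂, then every supporting pair (a, b) of (A, B) satisfies b₁ ≥ (β₂)₁; that is, the right endpoint of the upper bridge succeeds the edge β. (Bridge-search case 2.) -/
/-- `s` lies on or below the line through `p` and `q` (where `p.1 < q.1`). -/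
def OnOrBelow (p q s : ℝ × ℝ) : Prop :=
  (q.1 - p.1) * (s.2 - p.2) ≤ (s.1 - p.1) * (q.2 - p.2)

/-- `s` lies strictly below the line through `p` and `q`. -/
def StrictlyBelow (p q s : ℝ × ℝ) : Prop :=
  (q.1 - p.1) * (s.2 - p.2) < (s.1 - p.1) * (q.2 - p.2)

/-- `s` lies on or above the line through `p` and `q`. -/
def OnOrAbove (p q s : ℝ × ℝ) : Prop :=
  (q.1 - p.1) * (s.2 - p.2) ≥ (s.1 - p.1) * (q.2 - p.2)

/-- `s` lies on the line through `p` and `q`. -/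
def OnLine (p q s : ℝ × ℝ) : Prop :=
  (q.1 - p.1) * (s.2 - p.2) = (s.1 - p.1) * (q.2 - p.2)

/-- `(p, q)` is an upper supporting pair of the finite set `S`. -/
def UpperSupportingPair (S : Finset (ℝ × ℝ)) (p q : ℝ × ℝ) : Prop :=
  p ∈ S ∧ q ∈ S ∧ p.1 < q.1 ∧ ∀ s ∈ S, OnOrBelow p q s

/-- `A` and `B` are separated by the vertical line `x = m`. -/
def SeparatedBy (A B : Finset (ℝ × ℝ)) (m : ℝ) : Prop :=
  (∀ a ∈ A, a.1 < m) ∧ (∀ b ∈ B, m < b.1)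

/-- `(a, b) ∈ A × B` is a supporting pair of `(A, B)`. -/
def SupportingPair (A B : Finset (ℝ × ℝ)) (a b : ℝ × ℝ) : Prop :=
  a ∈ A ∧ b ∈ B ∧ ∀ s ∈ A ∪ B, OnOrBelow a b s

/-- A finite set is in general position if no three distinct points of it are collinear. -/
def GeneralPosition (S : Finset (ℝ × ℝ)) : Prop :=
  ∀ p ∈ S, ∀ q ∈ S, ∀ r ∈ S, p ≠ q → p ≠ r → q ≠ r →
    ¬ Collinear ℝ ({p, q, r} : Set (ℝ × ℝ))

/-- The slope of the segment from `p` to `q`. -/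
noncomputable def segSlope (p q : ℝ × ℝ) : ℝ := (q.2 - p.2) / (q.1 - p.1)

/-- The midpoint of the segment `pq`. -/
noncomputable def midpt (p q : ℝ × ℝ) : ℝ × ℝ := ((p.1 + q.1) / 2, (p.2 + q.2) / 2)

/-- `p` is an upper-hull vertex of `S`: some non-vertical line through `p`
has every other point of `S` strictly below it. -/
def UpperHullVertex (S : Finset (ℝ × ℝ)) (p : ℝ × ℝ) : Prop :=
  p ∈ S ∧ ∃ k : ℝ, ∀ s ∈ S, s ≠ p → s.2 < p.2 + k * (s.1 - p.1)

/-- `(p, q)` is an edge of the upper convex hull of `S`. -/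
def UpperHullEdge (S : Finset (ℝ × ℝ)) (p q : ℝ × ℝ) : Prop :=
  p ∈ S ∧ q ∈ S ∧ p.1 < q.1 ∧ ∀ s ∈ S, s ≠ p → s ≠ q → StrictlyBelow p q s

/-- A pair with positive horizontal gap lies on a non-vertical line of slope `k`, and being
on or below it is an inequality for the affine function with that slope. -/
theorem snd_eq_and_onOrBelow_iff {p q : ℝ × ℝ} (h : p.1 < q.1) :
    q.2 = p.2 + segSlope p q * (q.1 - p.1) ∧
      ∀ s, OnOrBelow p q s ↔ s.2 ≤ p.2 + segSlope p q * (s.1 - p.1) := by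
  have hpos : 0 < q.1 - p.1 := sub_pos.2 h
  have hq : segSlope p q * (q.1 - p.1) = q.2 - p.2 := div_mul_cancel₀ _ hpos.ne'
  refine ⟨by linarith, fun s => ?_⟩
  unfold OnOrBelow
  rw [← hq, show (s.1 - p.1) * (segSlope p q * (q.1 - p.1)) =
    (q.1 - p.1) * (segSlope p q * (s.1 - p.1)) by ring, mul_le_mul_iff_right₀ hpos]
  constructor <;> intro h <;> linarith

/-- Three points on a common line of slope `k` are collinear. -/
theorem collinear_of_slope {p q r : ℝ × ℝ} (k : ℝ) (hq : q.2 = p.2 + k * (q.1 - p.1))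
    (hr : r.2 = p.2 + k * (r.1 - p.1)) : Collinear ℝ ({p, q, r} : Set (ℝ × ℝ)) := by
  rw [collinear_iff_of_mem (p₀ := p) (by simp)]
  refine ⟨(1, k), fun s hs => ⟨s.1 - p.1, ?_⟩⟩
  have hs2 : s.2 = p.2 + k * (s.1 - p.1) := by
    rcases hs with rfl | rfl | rfl
    · ring
    · exact hq
    · exact hr
  ext
  · simp
  · simp only [vadd_eq_add, Prod.snd_add, Prod.smul_snd, smul_eq_mul]
    linarith

theorem bridge_case2
    (A B : Finset (ℝ × ℝ)) (m : ℝ) (hA : A.Nonempty) (hB : B.Nonempty)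
    (hsep : SeparatedBy A B m) (hgp : GeneralPosition (A ∪ B))
    (α₁ α₂ β₁ β₂ : ℝ × ℝ)
    (hα : UpperSupportingPair A α₁ α₂) (hβ : UpperSupportingPair B β₁ β₂)
    (hslope : segSlope (midpt α₁ α₂) (midpt β₁ β₂) ≤ segSlope β₁ β₂) :
    ∀ a b : ℝ × ℝ, SupportingPair A B a b → b.1 ≥ β₂.1 := by
  intro a b ⟨ha, hb, hab⟩
  obtain ⟨hα₁, hα₂, -, -⟩ := hα
  obtain ⟨hβ₁, hβ₂, hβlt, hβle⟩ := hβ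
  obtain ⟨hleft, hright⟩ := hsep
  by_contra! hlt
  have hablt : a.1 < b.1 := (hleft a ha).trans (hright b hb)
  obtain ⟨hβ₂eq, hβiff⟩ := snd_eq_and_onOrBelow_iff hβlt
  obtain ⟨hbeq, habiff⟩ := snd_eq_and_onOrBelow_iff hablt
  have hA' : ∀ s ∈ A, s.2 ≤ a.2 + segSlope a b * (s.1 - a.1) := fun s hs =>
    (habiff s).1 (hab s (Finset.mem_union_left B hs))
  have hB' : ∀ s ∈ B, s.2 ≤ a.2 + segSlope a b * (s.1 - a.1) := fun s hs =>
    (habiff s).1 (hab s (Finset.mem_union_right A hs))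
  have hbβ := (hβiff b).1 (hβle b hb)
  have hα₁m := hleft α₁ hα₁
  have hα₂m := hleft α₂ hα₂
  have hβ₁m := hright β₁ hβ₁
  have hβ₂m := hright β₂ hβ₂
  have hbm := hright b hb
  have ham := hleft a ha
  have hmid : (midpt α₁ α₂).1 < (midpt β₁ β₂).1 := by
    simp only [midpt]
    linarith
  generalize segSlope β₁ β₂ = k at *
  generalize segSlope a b = t at *
  -- the midpoint of `α₁α₂` lies on or above the line through `β₁` and `β₂`
  have habove : β₁.2 + k * ((α₁.1 + α₂.1) / 2 - β₁.1) ≤ (α₁.2 + α₂.2) / 2 := by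
    rw [segSlope, div_le_iff₀ (sub_pos.2 hmid)] at hslope
    simp only [midpt] at hslope
    linarith
  have h₁ := hA' α₁ hα₁
  have h₂ := hA' α₂ hα₂
  have h₃ := hB' β₂ hβ₂
  have hge : 0 ≤ t - k :=
    nonneg_of_mul_nonneg_left (b := β₂.1 - b.1) (by linarith) (by linarith)
  have hle : 0 ≤ k - t :=
    nonneg_of_mul_nonneg_left (b := b.1 - (α₁.1 + α₂.1) / 2) (by linarith) (by linarith)
  obtain rfl : t = k := by linarith
  refine hgp β₁ (Finset.mem_union_right A hβ₁) β₂ (Finset.mem_union_right A hβ₂)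
    a (Finset.mem_union_left B ha) ?_ ?_ ?_
    (collinear_of_slope t hβ₂eq (by linarith))
  · rintro rfl
    exact hβlt.false
  · rintro rfl
    linarith
  · rintro rfl
    linarith
end

section
/- Let A and B be finite nonempty subsets of ℝ × ℝ separated by the vertical line x = m, let (a, b) be a supporting pair of (A, B), and let (β₁, β₂) be an upper supporting pair of B with midpoint r (note a₁ < m < r₁, so the slope of ar is defined). If slope(ar) > slope(β₁β₂), then b₁ ≤ (β₁)₁; that is, the right endpoint of the upper bridge precedes the edge β. (Right-endpoint search, first case.) -/
/-- Slope form of `OnOrBelow`. -/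
theorem onOrBelow_iff_le_segSlope {p q s : ℝ × ℝ} (h : p.1 < q.1) :
    OnOrBelow p q s ↔ s.2 ≤ p.2 + segSlope p q * (s.1 - p.1) := by
  have hpos : 0 < q.1 - p.1 := sub_pos.2 h
  rw [OnOrBelow, segSlope, ← sub_le_iff_le_add', div_mul_eq_mul_div, le_div_iff₀ hpos,
    mul_comm (q.1 - p.1), mul_comm (s.1 - p.1)]

/-- The second endpoint of a non-vertical segment in terms of its slope. -/
theorem snd_eq_add_segSlope_mul {p q : ℝ × ℝ} (h : p.1 < q.1) :
    q.2 = p.2 + segSlope p q * (q.1 - p.1) := by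
  rw [segSlope, div_mul_cancel₀ _ (sub_pos.2 h).ne', add_sub_cancel]

/-- A point to the left of the midpoint of `pq` that sees it under a slope larger than that of `pq`
lies strictly below the line through `p` and `q`. -/
theorem snd_lt_of_segSlope_lt_segSlope_midpt {a p q : ℝ × ℝ} (hpq : p.1 < q.1) (hap : a.1 < p.1)
    (h : segSlope p q < segSlope a (midpt p q)) :
    a.2 < p.2 + segSlope p q * (a.1 - p.1) := by
  have hr : a.1 < (midpt p q).1 := by
    simp only [midpt]
    linarith
  have hmul := mul_lt_mul_of_pos_right h (sub_pos.2 hr)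
  have hmid := snd_eq_add_segSlope_mul hr
  have hq := snd_eq_add_segSlope_mul hpq
  generalize segSlope a (midpt p q) = l at *
  simp only [midpt] at hmul hmid
  linarith

theorem right_endpoint_case1
    (A B : Finset (ℝ × ℝ)) (m : ℝ) (hA : A.Nonempty) (hB : B.Nonempty)
    (hsep : SeparatedBy A B m)
    (a b : ℝ × ℝ) (hab : SupportingPair A B a b)
    (β₁ β₂ : ℝ × ℝ) (hβ : UpperSupportingPair B β₁ β₂)
    (hslope : segSlope a (midpt β₁ β₂) > segSlope β₁ β₂) :
    b.1 ≤ β₁.1 := by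
  obtain ⟨ha, hb, hbelow⟩ := hab
  obtain ⟨hβ₁, -, hlt, hβbelow⟩ := hβ
  have hab₁ : a.1 < b.1 := (hsep.1 a ha).trans (hsep.2 b hb)
  have haβ : a.1 < β₁.1 := (hsep.1 a ha).trans (hsep.2 β₁ hβ₁)
  have hb_le := (onOrBelow_iff_le_segSlope hlt).1 (hβbelow b hb)
  have hβ_le := (onOrBelow_iff_le_segSlope hab₁).1 (hbelow β₁ (Finset.mem_union_right A hβ₁))
  have ha_lt := snd_lt_of_segSlope_lt_segSlope_midpt hlt haβ hslope
  have hb_eq := snd_eq_add_segSlope_mul hab₁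
  have hslope_lt : segSlope β₁ β₂ < segSlope a b :=
    lt_of_mul_lt_mul_right (by linarith) (sub_pos.2 haβ).le
  by_contra! hcon
  have := mul_lt_mul_of_pos_right hslope_lt (sub_pos.2 hcon)
  linarith
end

section
/- Let A and B be finite nonempty subsets of ℝ × ℝ separated by the vertical line x = m, let (a, b) be a supporting pair of (A, B), and let (β₁, β₂) be an upper supporting pair of B with midpoint r. If slope(ar) = slope(β₁β₂), then the line through a and b coincides with the line through β₁ and β₂; consequently (a, β₂) is also a supporting pair of (A, B), so the maximal bridge of (A, B) has its right endpoint at x-coordinate at least (β₂)₁. (Right-endpoint search, collinear case.) -/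
theorem onOrBelow_iff_segSlope {p q : ℝ × ℝ} (h : p.1 < q.1) (s : ℝ × ℝ) :
    OnOrBelow p q s ↔ s.2 - p.2 ≤ (s.1 - p.1) * segSlope p q := by
  rw [OnOrBelow, segSlope, ← mul_div_assoc, le_div_iff₀ (sub_pos.2 h), mul_comm (q.1 - p.1)]

theorem onLine_iff_segSlope {p q : ℝ × ℝ} (h : p.1 < q.1) (s : ℝ × ℝ) :
    OnLine p q s ↔ s.2 - p.2 = (s.1 - p.1) * segSlope p q := by
  rw [OnLine, segSlope, ← mul_div_assoc, eq_div_iff (sub_pos.2 h).ne', mul_comm (q.1 - p.1)]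

theorem sub_eq_mul_segSlope {p q : ℝ × ℝ} (h : p.1 < q.1) :
    q.2 - p.2 = (q.1 - p.1) * segSlope p q := by
  rw [← onLine_iff_segSlope h, OnLine]

theorem right_endpoint_collinear
    (A B : Finset (ℝ × ℝ)) (m : ℝ) (hA : A.Nonempty) (hB : B.Nonempty)
    (hsep : SeparatedBy A B m)
    (a b : ℝ × ℝ) (hab : SupportingPair A B a b)
    (β₁ β₂ : ℝ × ℝ) (hβ : UpperSupportingPair B β₁ β₂)
    (hslope : segSlope a (midpt β₁ β₂) = segSlope β₁ β₂) :
    (∀ s : ℝ × ℝ, OnLine a b s ↔ OnLine β₁ β₂ s) ∧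
    SupportingPair A B a β₂ ∧
    (∀ a' b' : ℝ × ℝ, SupportingPair A B a' b' →
      (∀ a'' b'' : ℝ × ℝ, SupportingPair A B a'' b'' → a'.1 ≤ a''.1 ∧ b''.1 ≤ b'.1) →
      β₂.1 ≤ b'.1) := by
  obtain ⟨haA, hbB, hbelow⟩ := hab
  obtain ⟨h₁B, h₂B, h₁₂, hBbelow⟩ := hβ
  have lt_of_mem : ∀ c ∈ B, a.1 < c.1 := fun c hc => (hsep.1 a haA).trans (hsep.2 c hc)
  have hab₁ := lt_of_mem b hbB
  have ha₁ := lt_of_mem β₁ h₁B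
  have ha₂ := lt_of_mem β₂ h₂B
  have hr : a.1 < (midpt β₁ β₂).1 := by
    simp only [midpt]
    linarith
  have e₁₂ := sub_eq_mul_segSlope h₁₂
  have eb := sub_eq_mul_segSlope hab₁
  have er := sub_eq_mul_segSlope hr
  rw [hslope] at er
  simp only [midpt] at er
  have hb := (onOrBelow_iff_segSlope h₁₂ b).1 (hBbelow b hbB)
  have h₂ := (onOrBelow_iff_segSlope hab₁ β₂).1 (hbelow β₂ (Finset.mem_union_right A h₂B))
  have ea : a.2 - β₁.2 = (a.1 - β₁.1) * segSlope β₁ β₂ := by linarith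
  have hk : segSlope a b = segSlope β₁ β₂ := by
    apply le_antisymm
    · exact le_of_mul_le_mul_left (by linarith) (sub_pos.2 hab₁)
    · exact le_of_mul_le_mul_left (by linarith) (sub_pos.2 ha₂)
  have ha₂k : segSlope a β₂ = segSlope a b := by
    rw [hk, segSlope, div_eq_iff (sub_pos.2 ha₂).ne']
    linarith
  have hsupp : SupportingPair A B a β₂ := by
    refine ⟨haA, h₂B, fun s hs => ?_⟩
    rw [onOrBelow_iff_segSlope ha₂, ha₂k, ← onOrBelow_iff_segSlope hab₁]
    exact hbelow s hs
  refine ⟨fun s => ?_, hsupp, fun a' b' _ hmax => (hmax a β₂ hsupp).2⟩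
  rw [onLine_iff_segSlope hab₁, onLine_iff_segSlope h₁₂, hk]
  constructor <;> intro h <;> linarith
end

section
/- Let A and B be finite nonempty subsets of ℝ × ℝ separated by the vertical line x = m; assume A ∪ B is in general position and all points of A ∪ B have pairwise distinct x-coordinates. Let (a, b) be a supporting pair of (A, B). Then for every point p ∈ A: p is an upper-hull vertex of A ∪ B if and only if p is an upper-hull vertex of A and p₁ ≤ a₁. (The vertices of the upper hull of the union coming from the left set are exactly the left set's upper-hull vertices that precede the bridge.) -/
/-- A point on the non-vertical line through `p` and `q` is collinear with them. -/
theorem OnLine.collinear {p q s : ℝ × ℝ} (hpq : p.1 < q.1) (h : OnLine p q s) :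
    Collinear ℝ ({p, q, s} : Set (ℝ × ℝ)) := by
  have hne : q.1 - p.1 ≠ 0 := (sub_pos.2 hpq).ne'
  unfold OnLine at h
  rw [collinear_iff_of_mem (p₀ := p) (by simp)]
  refine ⟨q - p, ?_⟩
  rintro x (rfl | rfl | rfl)
  · exact ⟨0, by simp⟩
  · exact ⟨1, by simp⟩
  · refine ⟨(x.1 - p.1) / (q.1 - p.1), Prod.ext ?_ ?_⟩
    · simp [hne]
    · simp only [vadd_eq_add, Prod.snd_add, Prod.smul_snd, Prod.snd_sub, smul_eq_mul]
      field_simp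
      linarith

/-- In general position, only the two spanning points lie on a supporting line. -/
theorem GeneralPosition.strictlyBelow {S : Finset (ℝ × ℝ)} (hS : GeneralPosition S)
    {p q s : ℝ × ℝ} (hp : p ∈ S) (hq : q ∈ S) (hs : s ∈ S) (hpq : p.1 < q.1)
    (hsp : s ≠ p) (hsq : s ≠ q) (h : OnOrBelow p q s) : StrictlyBelow p q s :=
  lt_of_le_of_ne h fun heq =>
    hS p hp q hq s hs (fun e => hpq.ne (congrArg Prod.fst e)) hsp.symm hsq.symm
      (OnLine.collinear hpq heq)

/-- An upper-hull vertex to the left of `b` and on or below the line through `a` and `b`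
is not to the right of `a`. -/
theorem UpperHullVertex.fst_le {S : Finset (ℝ × ℝ)} {a b p : ℝ × ℝ}
    (hp : UpperHullVertex S p) (ha : a ∈ S) (hb : b ∈ S) (hpb : p.1 < b.1)
    (h : OnOrBelow a b p) : p.1 ≤ a.1 := by
  obtain ⟨-, k, hk⟩ := hp
  by_contra! hlt
  have h1 := hk a ha (by rintro rfl; exact hlt.false)
  have h2 := hk b hb (by rintro rfl; exact hpb.false)
  unfold OnOrBelow at h
  nlinarith [mul_lt_mul_of_pos_left h1 (sub_pos.2 hpb), mul_lt_mul_of_pos_left h2 (sub_pos.2 hlt)]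

/-- The left end of an upper hull edge is an upper-hull vertex. -/
theorem UpperHullEdge.upperHullVertex_left {S : Finset (ℝ × ℝ)} {a b : ℝ × ℝ}
    (h : UpperHullEdge S a b) : UpperHullVertex S a := by
  obtain ⟨ha, -, hab, hlt⟩ := h
  have hpos : 0 < b.1 - a.1 := sub_pos.2 hab
  have hslope : segSlope a b * (b.1 - a.1) = b.2 - a.2 := div_mul_cancel₀ _ hpos.ne'
  have hev : ∀ s ∈ S, ∀ᶠ k in nhdsWithin (segSlope a b) (Set.Ioi (segSlope a b)),
      s ≠ a → s.2 < a.2 + k * (s.1 - a.1) := by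
    intro s hs
    by_cases hsa : s = a
    · exact .of_forall fun _ hne => absurd hsa hne
    by_cases hsb : s = b
    · subst hsb
      filter_upwards [self_mem_nhdsWithin] with k hk _
      nlinarith [mul_lt_mul_of_pos_right (Set.mem_Ioi.1 hk) hpos]
    · have hs' : s.2 < a.2 + segSlope a b * (s.1 - a.1) := by
        have := hlt s hs hsa hsb
        unfold StrictlyBelow at this
        rw [← hslope] at this
        refine lt_of_mul_lt_mul_left ?_ hpos.le
        linarith
      have hcont : Continuous fun k : ℝ => a.2 + k * (s.1 - a.1) := by fun_prop
      filter_upwards [nhdsWithin_le_nhds (hcont.continuousAt.eventually (lt_mem_nhds hs'))]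
        with k hk _ using hk
  obtain ⟨k, hk⟩ := ((Filter.eventually_all_finset S).2 hev).exists
  exact ⟨ha, k, hk⟩

theorem left_hull_vertex_survives_iff
    (A B : Finset (ℝ × ℝ)) (m : ℝ) (hA : A.Nonempty) (hB : B.Nonempty)
    (hsep : SeparatedBy A B m) (hgp : GeneralPosition (A ∪ B))
    (hx : ∀ p ∈ A ∪ B, ∀ q ∈ A ∪ B, p ≠ q → p.1 ≠ q.1)
    (a b : ℝ × ℝ) (hab : SupportingPair A B a b) :
    ∀ p ∈ A, (UpperHullVertex (A ∪ B) p ↔ UpperHullVertex A p ∧ p.1 ≤ a.1) := by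
  obtain ⟨haA, hbB, hle⟩ := hab
  have haS := Finset.mem_union_left B haA
  have hbS := Finset.mem_union_right A hbB
  have hlt : a.1 < b.1 := (hsep.1 a haA).trans (hsep.2 b hbB)
  have hstrict : ∀ s ∈ A ∪ B, s ≠ a → s ≠ b → StrictlyBelow a b s := fun s hs hsa hsb =>
    hgp.strictlyBelow haS hbS hs hlt hsa hsb (hle s hs)
  intro p hpA
  have hpS := Finset.mem_union_left B hpA
  have hpb : p.1 < b.1 := (hsep.1 p hpA).trans (hsep.2 b hbB)
  constructor
  · intro hp
    refine ⟨⟨hpA, ?_⟩, hp.fst_le haS hbS hpb (hle p hpS)⟩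
    obtain ⟨-, k, hk⟩ := hp
    exact ⟨k, fun s hs => hk s (Finset.mem_union_left B hs)⟩
  · rintro ⟨⟨-, k, hk⟩, hpa⟩
    by_cases hne : p = a
    · subst hne
      exact UpperHullEdge.upperHullVertex_left ⟨haS, hbS, hlt, hstrict⟩
    refine ⟨hpS, k, fun s hs hsp => ?_⟩
    rcases Finset.mem_union.1 hs with hsA | hsB
    · exact hk s hsA hsp
    have hpa' : 0 < a.1 - p.1 := sub_pos.2 (lt_of_le_of_ne hpa (hx p hpS a haS hne))
    have has : 0 < s.1 - a.1 := sub_pos.2 ((hsep.1 a haA).trans (hsep.2 s hsB))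
    have hpos : 0 < b.1 - a.1 := sub_pos.2 hlt
    have hslope : segSlope a b * (b.1 - a.1) = b.2 - a.2 := div_mul_cancel₀ _ hpos.ne'
    have hka := hk a haA (Ne.symm hne)
    have hp := hstrict p hpS hne (fun e => hpb.ne (congrArg Prod.fst e))
    have hs := hle s hs
    unfold StrictlyBelow at hp
    unfold OnOrBelow at hs
    rw [← hslope] at hp hs
    have hp' : p.2 - a.2 < segSlope a b * (p.1 - a.1) :=
      lt_of_mul_lt_mul_left (by linarith) hpos.le
    have hs' : s.2 - a.2 ≤ segSlope a b * (s.1 - a.1) :=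
      le_of_mul_le_mul_left (by linarith) hpos
    have hslope_lt : segSlope a b < k :=
      lt_of_mul_lt_mul_right (by linarith) hpa'.le
    linarith [mul_lt_mul_of_pos_right hslope_lt has]
end
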